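/- arXiv:1702.08791 — 10 statements merged into one kernel-verified Lean document; each statement's English description precedes it below -/
import Mathlib

section
/- For every budget vector y : S → ℝ with y(s) ≥ 0 for all s, the map x ↦ I(y;x) is submodular on the nonnegative orthant: for all x, x' : E → ℝ with x, x' ≥ 0 componentwise, I(y;x) + I(y;x') ≥ I(y; x ∨ x') + I(y; x ∧ x'), where ∨ and ∧ denote the componentwise maximum and minimum. -/
open scoped BigOperators

/-- The expected influence `I(y;x)` for channels `S`, people `T`, edge set `E`,
budgets `y` and failure probabilities `x`; powers are real powers (`0^0 = 1`). -/
noncomputable def influence {S T : Type*} [Fintype T] [DecidableEq T]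
    (E : Finset (S × T)) (y : S → ℝ) (x : S × T → ℝ) : ℝ :=
  ∑ t : T, (1 - ∏ e ∈ E.filter (fun e => e.2 = t), x e ^ y e.1)

/-- The product of nonnegative reals is supermodular in its factors. -/
theorem prod_add_prod_le_prod_max_add_prod_min {ι : Type*} (A : Finset ι) (a b : ι → ℝ)
    (ha : ∀ i ∈ A, 0 ≤ a i) (hb : ∀ i ∈ A, 0 ≤ b i) :
    ∏ i ∈ A, a i + ∏ i ∈ A, b i ≤ ∏ i ∈ A, max (a i) (b i) + ∏ i ∈ A, min (a i) (b i) := by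
  classical
  induction A using Finset.induction_on with
  | empty => simp
  | insert i A hi ih =>
    rw [Finset.forall_mem_insert] at ha hb
    have ih := ih ha.2 hb.2
    have hP : ∏ j ∈ A, a j ≤ ∏ j ∈ A, max (a j) (b j) :=
      Finset.prod_le_prod ha.2 fun j _ => le_max_left _ _
    have hQ : ∏ j ∈ A, b j ≤ ∏ j ∈ A, max (a j) (b j) :=
      Finset.prod_le_prod hb.2 fun j _ => le_max_right _ _
    simp only [Finset.prod_insert hi]
    rcases le_total (a i) (b i) with h | h
    · rw [max_eq_right h, min_eq_left h]
      nlinarith [mul_nonneg (sub_nonneg.2 h) (sub_nonneg.2 hQ),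
        mul_nonneg ha.1 (sub_nonneg.2 ih)]
    · rw [max_eq_left h, min_eq_right h]
      nlinarith [mul_nonneg (sub_nonneg.2 h) (sub_nonneg.2 hP),
        mul_nonneg hb.1 (sub_nonneg.2 ih)]

/-- for any nonnegative budget `y`, the influence function is submodular
in the failure probabilities `x` over the nonnegative orthant. -/
theorem influence_submodular_in_x {S T : Type*} [Fintype S] [Fintype T] [DecidableEq T]
    (E : Finset (S × T)) (y : S → ℝ) (hy : ∀ s, 0 ≤ y s)
    (x x' : S × T → ℝ) (hx : ∀ e ∈ E, 0 ≤ x e) (hx' : ∀ e ∈ E, 0 ≤ x' e) :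
    influence E y x + influence E y x' ≥
      influence E y (fun e => max (x e) (x' e)) +
        influence E y (fun e => min (x e) (x' e)) := by
  unfold influence
  rw [ge_iff_le, ← Finset.sum_add_distrib, ← Finset.sum_add_distrib]
  refine Finset.sum_le_sum fun t _ => ?_
  have hE : ∀ e ∈ E.filter (fun e => e.2 = t), e ∈ E := fun e he => (Finset.mem_filter.1 he).1
  have hmono (e : S × T) : MonotoneOn (fun r : ℝ => r ^ y e.1) (Set.Ici 0) :=
    Real.monotoneOn_rpow_Ici_of_exponent_nonneg (hy e.1)
  have hmax : ∏ e ∈ E.filter (fun e => e.2 = t), max (x e) (x' e) ^ y e.1 =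
      ∏ e ∈ E.filter (fun e => e.2 = t), max (x e ^ y e.1) (x' e ^ y e.1) :=
    Finset.prod_congr rfl fun e he =>
      (hmono e).map_max (hx e (hE e he)) (hx' e (hE e he))
  have hmin : ∏ e ∈ E.filter (fun e => e.2 = t), min (x e) (x' e) ^ y e.1 =
      ∏ e ∈ E.filter (fun e => e.2 = t), min (x e ^ y e.1) (x' e ^ y e.1) :=
    Finset.prod_congr rfl fun e he =>
      (hmono e).map_min (hx e (hE e he)) (hx' e (hE e he))
  rw [hmax, hmin]
  linarith [prod_add_prod_le_prod_max_add_prod_min (E.filter (fun e => e.2 = t))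
    (fun e => x e ^ y e.1) (fun e => x' e ^ y e.1)
    (fun e he => Real.rpow_nonneg (hx e (hE e he)) _)
    (fun e he => Real.rpow_nonneg (hx' e (hE e he)) _)]
end

section
/- For every fixed vector x : E → ℝ with 0 ≤ x_{st} ≤ 1 for all (s,t) ∈ E, the map y ↦ I(y;x) is concave on the nonnegative orthant {y : S → ℝ : y ≥ 0}: for all y, y' ≥ 0 and θ ∈ [0,1], I(θy + (1−θ)y'; x) ≥ θ I(y;x) + (1−θ) I(y';x). -/
open scoped BigOperators

/-- A product of real powers of nonnegative bases is convex in nonnegative exponents. -/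
theorem prod_rpow_convex_combination_le {ι : Type*} (s : Finset ι) (x a b : ι → ℝ)
    (hx : ∀ i ∈ s, 0 ≤ x i) (ha : ∀ i ∈ s, 0 ≤ a i) (hb : ∀ i ∈ s, 0 ≤ b i)
    {θ : ℝ} (hθ₀ : 0 ≤ θ) (hθ₁ : θ ≤ 1) :
    ∏ i ∈ s, x i ^ (θ * a i + (1 - θ) * b i) ≤
      θ * ∏ i ∈ s, x i ^ a i + (1 - θ) * ∏ i ∈ s, x i ^ b i := by
  have hθ : 0 ≤ 1 - θ := sub_nonneg.2 hθ₁
  have hprod : ∏ i ∈ s, x i ^ (θ * a i + (1 - θ) * b i) =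
      (∏ i ∈ s, x i ^ a i) ^ θ * (∏ i ∈ s, x i ^ b i) ^ (1 - θ) := by
    rw [← Real.finsetProd_rpow s _ fun i hi => Real.rpow_nonneg (hx i hi) _,
      ← Real.finsetProd_rpow s _ fun i hi => Real.rpow_nonneg (hx i hi) _,
      ← Finset.prod_mul_distrib]
    refine Finset.prod_congr rfl fun i hi => ?_
    rw [Real.rpow_add_of_nonneg (hx i hi) (mul_nonneg hθ₀ (ha i hi)) (mul_nonneg hθ (hb i hi)),
      mul_comm θ, mul_comm (1 - θ), Real.rpow_mul (hx i hi), Real.rpow_mul (hx i hi)]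
  rw [hprod]
  exact Real.geom_mean_le_arith_mean2_weighted hθ₀ hθ
    (Finset.prod_nonneg fun i hi => Real.rpow_nonneg (hx i hi) _)
    (Finset.prod_nonneg fun i hi => Real.rpow_nonneg (hx i hi) _) (by ring)

/-- for fixed failure probabilities `x ∈ [0,1]^E`, the map `y ↦ I(y;x)`
is concave on the nonnegative orthant. -/
theorem influence_concave_in_y {S T : Type*} [Fintype S] [Fintype T] [DecidableEq T]
    (E : Finset (S × T)) (x : S × T → ℝ)
    (hx : ∀ e ∈ E, 0 ≤ x e ∧ x e ≤ 1) :
    ∀ y y' : S → ℝ, (∀ s, 0 ≤ y s) → (∀ s, 0 ≤ y' s) →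
      ∀ θ : ℝ, 0 ≤ θ → θ ≤ 1 →
        influence E (fun s => θ * y s + (1 - θ) * y' s) x ≥
          θ * influence E y x + (1 - θ) * influence E y' x := by
  intro y y' hy hy' θ hθ₀ hθ₁
  simp only [influence, ge_iff_le, Finset.mul_sum, ← Finset.sum_add_distrib]
  refine Finset.sum_le_sum fun t _ => ?_
  have h := prod_rpow_convex_combination_le (E.filter fun e => e.2 = t) x
    (fun e => y e.1) (fun e => y' e.1) (fun e he => (hx e (Finset.mem_filter.1 he).1).1)
    (fun e _ => hy e.1) (fun e _ => hy' e.1) hθ₀ hθ₁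
  linarith
end

section
/- Let (Ω, μ) be a probability space and X : Ω → (E → ℝ) a measurable random vector with 0 ≤ X_{st}(ω) ≤ 1 for all (s,t) ∈ E and all ω. Then the map y ↦ E[I(y;X)] = ∫_Ω I(y; X(ω)) dμ(ω) is concave on the nonnegative orthant {y : S → ℝ : y ≥ 0}. -/
open scoped BigOperators
open MeasureTheory

theorem Real.convexOn_prod_rpow {S ι : Type*} (F : Finset ι) (f : ι → S) (x : ι → ℝ)
    (hx : ∀ e, 0 ≤ x e) :
    ConvexOn ℝ {y : S → ℝ | ∀ s, 0 ≤ y s} (fun y => ∏ e ∈ F, x e ^ y (f e)) := by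
  refine ⟨convex_Ici (0 : S → ℝ), fun y hy z hz a b ha hb hab => ?_⟩
  have hlog : ∏ e ∈ F, x e ^ (a • y + b • z) (f e) =
      (∏ e ∈ F, x e ^ y (f e)) ^ a * (∏ e ∈ F, x e ^ z (f e)) ^ b := by
    rw [← Real.finsetProd_rpow _ _ (fun e _ => Real.rpow_nonneg (hx e) _),
      ← Real.finsetProd_rpow _ _ (fun e _ => Real.rpow_nonneg (hx e) _),
      ← Finset.prod_mul_distrib]
    refine Finset.prod_congr rfl fun e _ => ?_
    rw [← Real.rpow_mul (hx e), ← Real.rpow_mul (hx e),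
      ← Real.rpow_add_of_nonneg (hx e) (mul_nonneg (hy _) ha) (mul_nonneg (hz _) hb)]
    simp [mul_comm]
  simp only [hlog, smul_eq_mul]
  exact Real.geom_mean_le_arith_mean2_weighted ha hb
    (Finset.prod_nonneg fun e _ => Real.rpow_nonneg (hx e) _)
    (Finset.prod_nonneg fun e _ => Real.rpow_nonneg (hx e) _) hab

theorem influence_concaveOn {S T : Type*} [Fintype T] [DecidableEq T]
    (E : Finset (S × T)) (x : S × T → ℝ) (hx : ∀ e, 0 ≤ x e) :
    ConcaveOn ℝ {y : S → ℝ | ∀ s, 0 ≤ y s} (fun y => influence E y x) := by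
  refine ⟨convex_Ici (0 : S → ℝ), fun y hy z hz a b ha hb hab => ?_⟩
  simp only [influence, smul_eq_mul, Finset.mul_sum, ← Finset.sum_add_distrib]
  refine Finset.sum_le_sum fun t _ => ?_
  have h := (Real.convexOn_prod_rpow (E.filter fun e => e.2 = t) Prod.fst x hx).2
    hy hz ha hb hab
  simp only [smul_eq_mul] at h
  linarith

theorem integrable_influence {S T : Type*} [Fintype T] [DecidableEq T]
    (E : Finset (S × T)) {Ω : Type*} [MeasurableSpace Ω] (μ : Measure Ω) [IsFiniteMeasure μ]
    (X : Ω → S × T → ℝ) (hXmeas : ∀ e, Measurable (fun ω => X ω e))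
    (hXbound : ∀ e ω, 0 ≤ X ω e ∧ X ω e ≤ 1) {y : S → ℝ} (hy : ∀ s, 0 ≤ y s) :
    Integrable (fun ω => influence E y (X ω)) μ := by
  unfold influence
  refine integrable_finsetSum _ fun t _ => (integrable_const 1).sub ?_
  refine Integrable.of_bound (C := 1)
    (Finset.measurable_fun_prod _ fun e _ => (hXmeas e).pow_const _).aestronglyMeasurable
    (Filter.Eventually.of_forall fun ω => ?_)
  have hnonneg : ∀ e : S × T, 0 ≤ X ω e ^ y e.1 := fun e =>
    Real.rpow_nonneg (hXbound e ω).1 _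
  rw [Real.norm_of_nonneg (Finset.prod_nonneg fun e _ => hnonneg e)]
  exact Finset.prod_le_one (fun e _ => hnonneg e) fun e _ =>
    Real.rpow_le_one (hXbound e ω).1 (hXbound e ω).2 (hy _)

/-- for a random vector `X` of failure probabilities taking values in
`[0,1]^E`, the map `y ↦ E[I(y;X)]` is concave on the nonnegative orthant. -/
theorem expected_influence_concave_in_y {S T : Type*} [Fintype S] [Fintype T] [DecidableEq T]
    (E : Finset (S × T))
    {Ω : Type*} [MeasurableSpace Ω] (μ : Measure Ω) [IsProbabilityMeasure μ]
    (X : Ω → S × T → ℝ)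
    (hXmeas : ∀ e : S × T, Measurable (fun ω => X ω e))
    (hXbound : ∀ e : S × T, ∀ ω : Ω, 0 ≤ X ω e ∧ X ω e ≤ 1) :
    ConcaveOn ℝ {y : S → ℝ | ∀ s, 0 ≤ y s}
      (fun y => ∫ ω, influence E y (X ω) ∂μ) := by
  have hint {y : S → ℝ} (hy : ∀ s, 0 ≤ y s) :=
    integrable_influence E μ X hXmeas hXbound hy
  have hconv : Convex ℝ {y : S → ℝ | ∀ s, 0 ≤ y s} := convex_Ici (0 : S → ℝ)
  refine ⟨hconv, fun y hy z hz a b ha hb hab => ?_⟩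
  simp only [smul_eq_mul]
  rw [← integral_const_mul, ← integral_const_mul,
    ← integral_add ((hint hy).const_mul a) ((hint hz).const_mul b)]
  exact integral_mono (((hint hy).const_mul a).add ((hint hz).const_mul b))
    (hint (hconv hy hz ha hb hab)) fun ω =>
      (influence_concaveOn E (X ω) fun e => (hXbound e ω).1).2 hy hz ha hb hab
end

section
/- Define g : ℝ²_{≥0} → ℝ by g(y₁,y₂) = sqrt( 1/((1+2y₁)(1+2y₂)) − 1/((1+y₁)²(1+y₂)²) ). Then g is neither convex nor concave on ℝ²_{≥0}: there exist a, b ∈ ℝ²_{≥0} and θ ∈ (0,1) with g(θa + (1−θ)b) < θ g(a) + (1−θ) g(b), and there exist a', b' ∈ ℝ²_{≥0} and θ' ∈ (0,1) with g(θ'a' + (1−θ')b') > θ' g(a') + (1−θ') g(b'). -/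
/-- The standard deviation `g(y₁,y₂)` of `X₁^{y₁} X₂^{y₂}` for independent
uniform `X₁, X₂` on `[0,1]`. -/
noncomputable def stdDevProd (y₁ y₂ : ℝ) : ℝ :=
  Real.sqrt (1 / ((1 + 2*y₁) * (1 + 2*y₂)) - 1 / ((1 + y₁)^2 * (1 + y₂)^2))

theorem stdDevProd_zero_right {y : ℝ} (hy : 0 ≤ y) :
    stdDevProd y 0 = Real.sqrt (y ^ 2 / ((1 + 2 * y) * (1 + y) ^ 2)) := by
  unfold stdDevProd
  congr 1
  field_simp
  ring

theorem stdDevProd_four_zero : stdDevProd 4 0 = 4 / 15 := by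
  rw [stdDevProd_zero_right (by norm_num), Real.sqrt_eq_iff_mul_self_eq (by norm_num) (by norm_num)]
  norm_num

theorem stdDevProd_twelve_zero : stdDevProd 12 0 = 12 / 65 := by
  rw [stdDevProd_zero_right (by norm_num), Real.sqrt_eq_iff_mul_self_eq (by norm_num) (by norm_num)]
  norm_num

theorem stdDevProd_eight_zero_lt : stdDevProd 8 0 < 11 / 50 := by
  rw [stdDevProd_zero_right (by norm_num), Real.sqrt_lt' (by norm_num)]
  norm_num

theorem lt_stdDevProd_two_zero : 1 / 4 < stdDevProd 2 0 := by
  rw [stdDevProd_zero_right (by norm_num), Real.lt_sqrt (by norm_num)]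
  norm_num

theorem stdDevProd_zero_zero : stdDevProd 0 0 = 0 := by
  simp [stdDevProd]

/-- `g` is neither convex nor concave on the nonnegative quadrant. -/
theorem stdDevProd_not_convex_not_concave :
    (∃ (a b : ℝ × ℝ) (θ : ℝ), 0 ≤ a.1 ∧ 0 ≤ a.2 ∧ 0 ≤ b.1 ∧ 0 ≤ b.2 ∧
      0 < θ ∧ θ < 1 ∧
      stdDevProd (θ * a.1 + (1 - θ) * b.1) (θ * a.2 + (1 - θ) * b.2) <
        θ * stdDevProd a.1 a.2 + (1 - θ) * stdDevProd b.1 b.2) ∧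
    (∃ (a b : ℝ × ℝ) (θ : ℝ), 0 ≤ a.1 ∧ 0 ≤ a.2 ∧ 0 ≤ b.1 ∧ 0 ≤ b.2 ∧
      0 < θ ∧ θ < 1 ∧
      stdDevProd (θ * a.1 + (1 - θ) * b.1) (θ * a.2 + (1 - θ) * b.2) >
        θ * stdDevProd a.1 a.2 + (1 - θ) * stdDevProd b.1 b.2) := by
  constructor
  · refine ⟨(4, 0), (12, 0), 1 / 2, by norm_num, by norm_num, by norm_num, by norm_num,
      by norm_num, by norm_num, ?_⟩
    have h₁ : (1 / 2 * 4 + (1 - 1 / 2) * 12 : ℝ) = 8 := by norm_num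
    have h₂ : (1 / 2 * 0 + (1 - 1 / 2) * 0 : ℝ) = 0 := by norm_num
    dsimp only
    rw [h₁, h₂, stdDevProd_four_zero, stdDevProd_twelve_zero]
    linarith [stdDevProd_eight_zero_lt]
  · refine ⟨(0, 0), (4, 0), 1 / 2, by norm_num, by norm_num, by norm_num, by norm_num,
      by norm_num, by norm_num, ?_⟩
    have h₁ : (1 / 2 * 0 + (1 - 1 / 2) * 4 : ℝ) = 2 := by norm_num
    have h₂ : (1 / 2 * 0 + (1 - 1 / 2) * 0 : ℝ) = 0 := by norm_num
    dsimp only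
    rw [h₁, h₂, stdDevProd_zero_zero, stdDevProd_four_zero]
    linarith [lt_stdDevProd_two_zero]
end

section
/- Define g : ℝ²_{≥0} → ℝ by g(y₁,y₂) = sqrt( 1/((1+2y₁)(1+2y₂)) − 1/((1+y₁)²(1+y₂)²) ). Then g is neither submodular nor supermodular on ℝ²_{≥0}: there exist a, b ∈ ℝ²_{≥0} with g(a) + g(b) < g(a ∨ b) + g(a ∧ b), and there exist a', b' ∈ ℝ²_{≥0} with g(a') + g(b') > g(a' ∨ b') + g(a' ∧ b'), where ∨ and ∧ denote the componentwise maximum and minimum. -/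
/-- `g` is neither submodular nor supermodular on the nonnegative quadrant. -/
theorem stdDevProd_not_submodular_not_supermodular :
    (∃ a b : ℝ × ℝ, 0 ≤ a.1 ∧ 0 ≤ a.2 ∧ 0 ≤ b.1 ∧ 0 ≤ b.2 ∧
      stdDevProd a.1 a.2 + stdDevProd b.1 b.2 <
        stdDevProd (max a.1 b.1) (max a.2 b.2) + stdDevProd (min a.1 b.1) (min a.2 b.2)) ∧
    (∃ a b : ℝ × ℝ, 0 ≤ a.1 ∧ 0 ≤ a.2 ∧ 0 ≤ b.1 ∧ 0 ≤ b.2 ∧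
      stdDevProd a.1 a.2 + stdDevProd b.1 b.2 >
        stdDevProd (max a.1 b.1) (max a.2 b.2) + stdDevProd (min a.1 b.1) (min a.2 b.2)) := by
  refine ⟨⟨(1, 13), (13, 1), by norm_num, by norm_num, by norm_num, by norm_num, ?_⟩,
    ⟨(1, 0), (0, 1), by norm_num, by norm_num, by norm_num, by norm_num, ?_⟩⟩
  · have h₁ : stdDevProd 1 13 < 0.106 := by
      rw [stdDevProd, Real.sqrt_lt' (by norm_num)]; norm_num
    have h₂ : stdDevProd 13 1 < 0.106 := by
      rw [stdDevProd, Real.sqrt_lt' (by norm_num)]; norm_num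
    have h₃ : 0.22 < stdDevProd 1 1 := by
      rw [stdDevProd, Real.lt_sqrt (by norm_num)]; norm_num
    have h₄ : 0 ≤ stdDevProd 13 13 := Real.sqrt_nonneg _
    have hmax : max (1 : ℝ) 13 = 13 := by norm_num
    have hmin : min (1 : ℝ) 13 = 1 := by norm_num
    simp only [max_comm (13 : ℝ) 1, min_comm (13 : ℝ) 1, hmax, hmin]
    linarith
  · have h₁ : 0.28 < stdDevProd 1 0 := by
      rw [stdDevProd, Real.lt_sqrt (by norm_num)]; norm_num
    have h₂ : 0.28 < stdDevProd 0 1 := by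
      rw [stdDevProd, Real.lt_sqrt (by norm_num)]; norm_num
    have h₃ : stdDevProd 1 1 < 0.23 := by
      rw [stdDevProd, Real.sqrt_lt' (by norm_num)]; norm_num
    have h₄ : stdDevProd 0 0 = 0 := by norm_num [stdDevProd]
    have hmax : max (1 : ℝ) 0 = 1 := by norm_num
    have hmin : min (1 : ℝ) 0 = 0 := by norm_num
    simp only [max_comm (0 : ℝ) 1, min_comm (0 : ℝ) 1, hmax, hmin]
    linarith
end

section
/- Let y : S → ℝ satisfy, for every s ∈ S, either y(s) = 0 or y(s) ≥ 1. Then the influence function x ↦ I(y;x) is DR-submodular in x on the open cube (0,1)^E: for every pair of edges e, e' ∈ E (possibly equal) and every x with 0 < x_{st} < 1 for all (s,t) ∈ E, the second partial derivative ∂²I(y;x)/∂x_e ∂x_{e'} is ≤ 0. -/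
open scoped BigOperators

/-- Isolates the factor of a weighted power product that depends on one coordinate. -/
lemma prod_rpow_update_of_mem {ι : Type*} [DecidableEq ι] {F : Finset ι} {e : ι} (he : e ∈ F)
    (w z : ι → ℝ) (t : ℝ) :
    ∏ f ∈ F, Function.update z e t f ^ w f = (∏ f ∈ F.erase e, z f ^ w f) * t ^ w e := by
  rw [← Finset.prod_erase_mul F _ he, Function.update_self]
  congr 1
  refine Finset.prod_congr rfl fun f hf => ?_
  rw [Function.update_of_ne (Finset.ne_of_mem_erase hf)]

/-- A weighted power product does not depend on a coordinate outside its index set. -/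
lemma prod_rpow_update_of_notMem {ι : Type*} [DecidableEq ι] {F : Finset ι} {e : ι} (he : e ∉ F)
    (w z : ι → ℝ) (t : ℝ) :
    ∏ f ∈ F, Function.update z e t f ^ w f = ∏ f ∈ F, z f ^ w f := by
  refine Finset.prod_congr rfl fun f hf => ?_
  rw [Function.update_of_ne (ne_of_mem_of_not_mem hf he)]

lemma deriv_rpow_of_eq_zero_or_one_le {a : ℝ} (ha : a = 0 ∨ 1 ≤ a) :
    deriv (fun t : ℝ => t ^ a) = fun t => a * t ^ (a - 1) := by
  funext t
  rcases ha with rfl | ha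
  · simp
  · exact (Real.hasDerivAt_rpow_const (Or.inr ha)).deriv

/-- As a function of the coordinate `e`, the influence is a constant minus a multiple of a power,
which gives its first partial derivative. -/
lemma deriv_influence_update {S T : Type*} [Fintype T] [DecidableEq S] [DecidableEq T]
    {E : Finset (S × T)} {y : S → ℝ} {e : S × T} (hy : y e.1 = 0 ∨ 1 ≤ y e.1) (he : e ∈ E)
    (z : S × T → ℝ) (u : ℝ) :
    deriv (fun t : ℝ => influence E y (Function.update z e t)) u =
      -((∏ f ∈ (E.filter (fun f => f.2 = e.2)).erase e, z f ^ y f.1) *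
        (y e.1 * u ^ (y e.1 - 1))) := by
  have key : (fun t : ℝ => influence E y (Function.update z e t)) = fun t =>
      ((∑ r ∈ Finset.univ.erase e.2, (1 - ∏ f ∈ E.filter (fun f => f.2 = r), z f ^ y f.1)) + 1) -
        (∏ f ∈ (E.filter (fun f => f.2 = e.2)).erase e, z f ^ y f.1) * t ^ y e.1 := by
    funext t
    rw [influence, ← Finset.sum_erase_add _ _ (Finset.mem_univ e.2),
      prod_rpow_update_of_mem (e := e) (by simp [he]) (fun f => y f.1), add_sub_assoc]
    congr 1
    refine Finset.sum_congr rfl fun r hr => ?_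
    rw [prod_rpow_update_of_notMem (e := e) _ (fun f => y f.1)]
    simpa [he] using (Finset.ne_of_mem_erase hr).symm
  rw [key, deriv_const_sub, deriv_const_mul_field, deriv_rpow_of_eq_zero_or_one_le hy]

/-- if every budget `y(s)` is `0` or at least `1`, then `x ↦ I(y;x)` is
DR-submodular on the open cube: every second partial derivative (including diagonal
ones) is nonpositive. -/
theorem influence_DR_submodular_in_x {S T : Type*} [Fintype S] [Fintype T]
    [DecidableEq S] [DecidableEq T]
    (E : Finset (S × T)) (y : S → ℝ) (hy : ∀ s, y s = 0 ∨ 1 ≤ y s)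
    (e e' : S × T) (he : e ∈ E) (he' : e' ∈ E)
    (x : S × T → ℝ) (hx : ∀ f ∈ E, 0 < x f ∧ x f < 1) :
    deriv (fun t' : ℝ =>
        deriv (fun t : ℝ =>
            influence E y (Function.update (Function.update x e' t') e t))
          (Function.update x e' t' e))
      (x e') ≤ 0 := by
  have hprod : ∀ F ⊆ E, 0 ≤ ∏ f ∈ F, x f ^ y f.1 := fun F hF =>
    Finset.prod_nonneg fun f hf => Real.rpow_nonneg (hx f (hF hf)).1.le _
  have hy0 : ∀ s, 0 ≤ y s := fun s => by rcases hy s with h | h <;> linarith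
  simp only [deriv_influence_update (hy e.1) he]
  rw [deriv.fun_neg, neg_nonpos]
  set F := (E.filter (fun f => f.2 = e.2)).erase e
  have hFE : F ⊆ E := (Finset.erase_subset _ _).trans (Finset.filter_subset _ _)
  by_cases hee : e = e'
  · subst hee
    have hnot : e ∉ F := Finset.notMem_erase _ _
    simp only [prod_rpow_update_of_notMem hnot (fun f => y f.1), Function.update_self,
      deriv_const_mul_field]
    rw [(Real.hasDerivAt_rpow_const (Or.inl (hx e he).1.ne')).deriv]
    refine mul_nonneg (hprod F hFE) ?_
    rcases hy e.1 with h | h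
    · simp [h]
    · have := (hx e he).1
      have := sub_nonneg.2 h
      positivity
  · simp only [Function.update_of_ne hee, deriv_mul_const_field]
    refine mul_nonneg ?_ (mul_nonneg (hy0 _) (Real.rpow_nonneg (hx e he).1.le _))
    by_cases hmem : e' ∈ F
    · simp only [prod_rpow_update_of_mem hmem (fun f => y f.1), deriv_const_mul_field,
        deriv_rpow_of_eq_zero_or_one_le (hy e'.1)]
      exact mul_nonneg (hprod _ ((Finset.erase_subset _ _).trans hFE))
        (mul_nonneg (hy0 _) (Real.rpow_nonneg (hx e' he').1.le _))
    · simp [prod_rpow_update_of_notMem hmem (fun f => y f.1)]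
end

section
/- Let 𝒳 be a nonempty subset of (0,1]^E, let y₀ : S → ℝ with y₀ ≥ 0, and let x* ∈ 𝒳 satisfy I(y₀;x*) = inf_{x∈𝒳} I(y₀;x). Define g : S → ℝ by g(s) = Σ_{t : (s,t)∈E} (−ln x*_{st}) · ∏_{(s',t)∈E} (x*_{s't})^{y₀(s')}. Then g is a supergradient of F(y) := inf_{x∈𝒳} I(y;x) at y₀: for all y : S → ℝ with y ≥ 0, F(y) ≤ F(y₀) + Σ_{s∈S} g(s)(y(s) − y₀(s)). -/
open scoped BigOperators

/-- The budget-dependent failure probability `∏ xᵢ ^ aᵢ` lies above its tangent plane. -/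
lemma prod_rpow_mul_one_add_le {ι : Type*} (A : Finset ι) (x a b : ι → ℝ)
    (hx : ∀ i ∈ A, 0 < x i) :
    (∏ i ∈ A, x i ^ a i) * (1 + ∑ i ∈ A, Real.log (x i) * (b i - a i)) ≤
      ∏ i ∈ A, x i ^ b i := by
  have hexp (c : ι → ℝ) :
      ∏ i ∈ A, x i ^ c i = Real.exp (∑ i ∈ A, Real.log (x i) * c i) := by
    rw [Real.exp_sum]
    exact Finset.prod_congr rfl fun i hi => Real.rpow_def_of_pos (hx i hi) _
  have hsplit : ∑ i ∈ A, Real.log (x i) * b i =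
      ∑ i ∈ A, Real.log (x i) * a i + ∑ i ∈ A, Real.log (x i) * (b i - a i) := by
    rw [← Finset.sum_add_distrib]
    exact Finset.sum_congr rfl fun i _ => by ring
  rw [hexp a, hexp b, hsplit, Real.exp_add]
  gcongr
  linarith [Real.add_one_le_exp (∑ i ∈ A, Real.log (x i) * (b i - a i))]

lemma influence_nonneg {S T : Type*} [Fintype T] [DecidableEq T]
    (E : Finset (S × T)) (y : S → ℝ) (x : S × T → ℝ) (hy : ∀ s, 0 ≤ y s)
    (hx : ∀ e ∈ E, 0 < x e ∧ x e ≤ 1) : 0 ≤ influence E y x := by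
  refine Finset.sum_nonneg fun t _ => sub_nonneg.2 ?_
  refine Finset.prod_le_one (fun e he => ?_) (fun e he => ?_)
  · exact Real.rpow_nonneg (hx e (Finset.mem_filter.1 he).1).1.le _
  · have h := hx e (Finset.mem_filter.1 he).1
    exact Real.rpow_le_one h.1.le h.2 (hy _)

/-- The influence lies below its tangent plane in the budget. -/
lemma influence_le_add_sum {S T : Type*} [Fintype T] [DecidableEq T]
    (E : Finset (S × T)) (y₀ y : S → ℝ) (x : S × T → ℝ) (hx : ∀ e ∈ E, 0 < x e) :
    influence E y x ≤ influence E y₀ x +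
      ∑ t : T, ∑ e ∈ E.filter (fun e => e.2 = t), -Real.log (x e) *
        (∏ e ∈ E.filter (fun e => e.2 = t), x e ^ y₀ e.1) * (y e.1 - y₀ e.1) := by
  unfold influence
  rw [← Finset.sum_add_distrib]
  refine Finset.sum_le_sum fun t _ => ?_
  have h := prod_rpow_mul_one_add_le (E.filter (fun e => e.2 = t)) x
    (fun e => y₀ e.1) (fun e => y e.1) fun e he => hx e (Finset.mem_filter.1 he).1
  rw [mul_add, mul_one, Finset.mul_sum] at h
  have hneg (P : ℝ) : ∑ e ∈ E.filter (fun e => e.2 = t),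
      -Real.log (x e) * P * (y e.1 - y₀ e.1) =
      -∑ e ∈ E.filter (fun e => e.2 = t), P * (Real.log (x e) * (y e.1 - y₀ e.1)) := by
    rw [← Finset.sum_neg_distrib]
    exact Finset.sum_congr rfl fun e _ => by ring
  rw [hneg]
  linarith

/-- Summing over edges grouped by source agrees with summing grouped by target. -/
lemma sum_source_eq_sum_target {S T : Type*} [Fintype S] [Fintype T]
    [DecidableEq S] [DecidableEq T] (E : Finset (S × T)) (f : S → T → ℝ) :
    ∑ s, ∑ t ∈ Finset.univ.filter (fun t : T => (s, t) ∈ E), f s t =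
      ∑ t, ∑ e ∈ E.filter (fun e => e.2 = t), f e.1 t := by
  have h : ∀ t, ∑ e ∈ E.filter (fun e => e.2 = t), f e.1 t =
      ∑ e ∈ E.filter (fun e => e.2 = t), f e.1 e.2 := fun t =>
    Finset.sum_congr rfl fun e he => by rw [(Finset.mem_filter.1 he).2]
  simp_rw [h]
  rw [Finset.sum_fiberwise]
  simp_rw [Finset.sum_filter]
  rw [← Fintype.sum_prod_type' (f := fun s t => if (s, t) ∈ E then f s t else 0)]
  simp

/-- the gradient in `y` of `I(·;x*)` at `y₀`, where `x*` attains the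
worst case at `y₀`, is a supergradient of `F(y) = inf_{x ∈ 𝒳} I(y;x)` at `y₀`. -/
theorem danskin_supergradient {S T : Type*} [Fintype S] [Fintype T]
    [DecidableEq S] [DecidableEq T]
    (E : Finset (S × T)) (𝒳 : Set (S × T → ℝ)) (h𝒳ne : 𝒳.Nonempty)
    (h𝒳 : ∀ x ∈ 𝒳, ∀ e ∈ E, 0 < x e ∧ x e ≤ 1)
    (y₀ : S → ℝ) (hy₀ : ∀ s, 0 ≤ y₀ s)
    (xstar : S × T → ℝ) (hxstar : xstar ∈ 𝒳)
    (hxopt : influence E y₀ xstar = ⨅ x : 𝒳, influence E y₀ (x : S × T → ℝ))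
    (g : S → ℝ)
    (hg : ∀ s, g s =
      ∑ t ∈ Finset.univ.filter (fun t : T => (s, t) ∈ E),
        (-Real.log (xstar (s, t))) *
          ∏ e ∈ E.filter (fun e => e.2 = t), xstar e ^ y₀ e.1) :
    ∀ y : S → ℝ, (∀ s, 0 ≤ y s) →
      (⨅ x : 𝒳, influence E y (x : S × T → ℝ)) ≤
        (⨅ x : 𝒳, influence E y₀ (x : S × T → ℝ)) + ∑ s, g s * (y s - y₀ s) := by
  intro y hy
  have hbdd : BddBelow (Set.range fun x : 𝒳 => influence E y (x : S × T → ℝ)) :=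
    ⟨0, by rintro _ ⟨x, rfl⟩; exact influence_nonneg E y x hy (h𝒳 x x.2)⟩
  have hsum : ∑ s, g s * (y s - y₀ s) =
      ∑ t : T, ∑ e ∈ E.filter (fun e => e.2 = t), -Real.log (xstar e) *
        (∏ e ∈ E.filter (fun e => e.2 = t), xstar e ^ y₀ e.1) * (y e.1 - y₀ e.1) := by
    simp_rw [hg, Finset.sum_mul]
    rw [sum_source_eq_sum_target E fun s t => -Real.log (xstar (s, t)) *
      (∏ e ∈ E.filter (fun e => e.2 = t), xstar e ^ y₀ e.1) * (y s - y₀ s)]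
    refine Finset.sum_congr rfl fun t _ => Finset.sum_congr rfl fun e he => ?_
    rw [← (Finset.mem_filter.1 he).2]
  rw [← hxopt, hsum]
  exact (ciInf_le hbdd ⟨xstar, hxstar⟩).trans
    (influence_le_add_sum E y₀ y xstar fun e he => (h𝒳 xstar hxstar e he).1)
end

section
/- Let n ≥ 1, l, u ∈ ℝ^n with l ≤ u, G ≥ 0, δ > 0 and B ∈ ℝ. Let H : ℝ^n → ℝ satisfy |H(x) − H(x')| ≤ G·‖x − x'‖_∞ for all x, x' in the box [l,u], and let R : ℝ^n → ℝ be nondecreasing with respect to the componentwise order on [l,u]. For each i, let G_i ⊆ [l_i,u_i] be a finite grid containing l_i and u_i whose consecutive points are at distance at most δ (a δ-fine discretization). Then for every x ∈ [l,u] with R(x) ≤ B there exists a grid point x' ∈ ∏_{i=1}^n G_i with x' ≤ x componentwise, ‖x − x'‖_∞ ≤ δ, R(x') ≤ B, and H(x') ≤ H(x) + Gδ. In particular, the minimum of H over feasible grid points is at most Gδ plus the infimum of H over the feasible continuous set {x ∈ [l,u] : R(x) ≤ B}. -/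
/-- If consecutive points of a finite set `S` are at distance at most `δ`, then every real number
between two points of `S` lies at most `δ` above some point of `S`. -/
theorem Finset.exists_mem_le_sub_le_of_gaps_le {S : Finset ℝ} {l u t δ : ℝ} (hδ : 0 ≤ δ)
    (hl : l ∈ S) (hu : u ∈ S) (hlt : l ≤ t) (htu : t ≤ u)
    (hfine : ∀ a ∈ S, ∀ b ∈ S, a < b → (∀ c ∈ S, ¬ (a < c ∧ c < b)) → b - a ≤ δ) :
    ∃ a ∈ S, a ≤ t ∧ t - a ≤ δ := by
  obtain ⟨a, ha, hamax⟩ := (S.filter (· ≤ t)).exists_max_image id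
    ⟨l, Finset.mem_filter.2 ⟨hl, hlt⟩⟩
  obtain ⟨b, hb, hbmin⟩ := (S.filter (t ≤ ·)).exists_min_image id
    ⟨u, Finset.mem_filter.2 ⟨hu, htu⟩⟩
  simp only [Finset.mem_filter, id, and_imp] at ha hamax hb hbmin
  refine ⟨a, ha.1, ha.2, ?_⟩
  rcases (ha.2.trans hb.2).eq_or_lt with hab | hab
  · linarith [hb.2]
  · have hgap := hfine a ha.1 b hb.1 hab fun c hc ⟨hac, hcb⟩ => by
      rcases le_total c t with h | h
      · exact (hamax c hc h).not_gt hac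
      · exact (hbmin c hc h).not_gt hcb
    linarith [hb.2]

/-- discretization step.  For an `ℓ∞`-Lipschitz objective `H`, a
componentwise-nondecreasing constraint `R`, and a `δ`-fine grid in each coordinate
(consecutive grid points at distance at most `δ`, with the endpoints of the box in
the grid), every feasible continuous point admits a feasible grid point below it
within `ℓ∞` distance `δ` whose `H`-value is at most `Gδ` larger. -/
theorem discretization_approximation
    (n : ℕ) (hn : 1 ≤ n) (l u : Fin n → ℝ) (hlu : ∀ i, l i ≤ u i)
    (G δ B : ℝ) (hG : 0 ≤ G) (hδ : 0 < δ)
    (H R : (Fin n → ℝ) → ℝ)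
    (hH : ∀ x x' : Fin n → ℝ, (∀ i, x i ∈ Set.Icc (l i) (u i)) →
      (∀ i, x' i ∈ Set.Icc (l i) (u i)) → |H x - H x'| ≤ G * ‖x - x'‖)
    (hR : ∀ x x' : Fin n → ℝ, (∀ i, x i ∈ Set.Icc (l i) (u i)) →
      (∀ i, x' i ∈ Set.Icc (l i) (u i)) → x ≤ x' → R x ≤ R x')
    (Gr : Fin n → Finset ℝ)
    (hGr_sub : ∀ i, ↑(Gr i) ⊆ Set.Icc (l i) (u i))
    (hGr_l : ∀ i, l i ∈ Gr i) (hGr_u : ∀ i, u i ∈ Gr i)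
    (hGr_fine : ∀ i, ∀ a ∈ Gr i, ∀ b ∈ Gr i, a < b →
      (∀ c ∈ Gr i, ¬ (a < c ∧ c < b)) → b - a ≤ δ) :
    ∀ x : Fin n → ℝ, (∀ i, x i ∈ Set.Icc (l i) (u i)) → R x ≤ B →
      ∃ x' : Fin n → ℝ, (∀ i, x' i ∈ Gr i) ∧ x' ≤ x ∧ ‖x - x'‖ ≤ δ ∧
        R x' ≤ B ∧ H x' ≤ H x + G * δ := by
  intro x hx hxB
  choose y hyG hyx hyδ using fun i =>
    Finset.exists_mem_le_sub_le_of_gaps_le hδ.le (hGr_l i) (hGr_u i) (hx i).1 (hx i).2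
      (hGr_fine i)
  have hy : ∀ i, y i ∈ Set.Icc (l i) (u i) := fun i => hGr_sub i (hyG i)
  have hnorm : ‖x - y‖ ≤ δ := by
    refine (pi_norm_le_iff_of_nonneg hδ.le).2 fun i => ?_
    rw [Pi.sub_apply, Real.norm_of_nonneg (sub_nonneg.2 (hyx i))]
    exact hyδ i
  refine ⟨y, hyG, hyx, hnorm, (hR y x hy hx hyx).trans hxB, ?_⟩
  linarith [(abs_le.1 (hH x y hx hy)).1, mul_le_mul_of_nonneg_left hnorm hG]
end

section
/- Let D be a nonempty finite set, H, R : D → ℝ, B ∈ ℝ, ε ≥ 0, and λ₊, λ₋ ≥ 0. Suppose x₊ ∈ D minimizes x ↦ H(x) + λ₊(R(x) − B) over D with R(x₊) ≥ B, and x₋ ∈ D minimizes x ↦ H(x) + λ₋(R(x) − B) over D with R(x₋) ≤ B, and that |H(x₊) − H(x₋)| ≤ ε. Let x* minimize H over the feasible set {x ∈ D : R(x) ≤ B}. Then H(x₊) ≤ H(x*) ≤ H(x₋) and |H(x*) − H(x₋)| ≤ ε. -/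
/-- sandwich bound.  An over-budget Lagrangian minimizer `x₊` and a
feasible Lagrangian minimizer `x₋` with `|H(x₊) − H(x₋)| ≤ ε` sandwich the
constrained optimum `x*` up to `ε`. -/
theorem lagrangian_sandwich {α : Type*} [Fintype α] [Nonempty α]
    (H R : α → ℝ) (B ε lamp lamm : ℝ) (hε : 0 ≤ ε)
    (hlamp : 0 ≤ lamp) (hlamm : 0 ≤ lamm)
    (xp xm xstar : α)
    (hminp : ∀ x : α, H xp + lamp * (R xp - B) ≤ H x + lamp * (R x - B))
    (hoverp : B ≤ R xp)
    (hminm : ∀ x : α, H xm + lamm * (R xm - B) ≤ H x + lamm * (R x - B))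
    (hfeasm : R xm ≤ B)
    (hclose : |H xp - H xm| ≤ ε)
    (hstar_feas : R xstar ≤ B)
    (hstar_opt : ∀ x : α, R x ≤ B → H xstar ≤ H x) :
    H xp ≤ H xstar ∧ H xstar ≤ H xm ∧ |H xstar - H xm| ≤ ε := by
  have lower : H xp ≤ H xstar := by
    have hp : 0 ≤ lamp * (R xp - B) := mul_nonneg hlamp (sub_nonneg.2 hoverp)
    have hs : lamp * (R xstar - B) ≤ 0 :=
      mul_nonpos_of_nonneg_of_nonpos hlamp (sub_nonpos.2 hstar_feas)
    linarith [hminp xstar]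
  have upper : H xstar ≤ H xm := hstar_opt xm hfeasm
  refine ⟨lower, upper, abs_le.2 ⟨?_, ?_⟩⟩ <;> linarith [(abs_le.1 hclose).1]
end

section
/- Define f₁ on the grid {0,1,2} × {0,1,2} by f₁(x₁,x₂) = −x₁² − 2x₁x₂. Then (i) f₁ is DR-submodular: for all x ≤ y in {0,1,2}² (componentwise) and each coordinate i ∈ {1,2} with y + e_i ∈ {0,1,2}², one has f₁(x + e_i) − f₁(x) ≥ f₁(y + e_i) − f₁(y); and (ii) f₁ violates discrete midpoint convexity at the pair (0,0), (2,2): f₁(0,0) + f₁(2,2) < 2·f₁(1,1). -/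
/-- `f₁(x₁,x₂) = −x₁² − 2x₁x₂` on the grid `{0,1,2}²` is DR-submodular
but violates discrete midpoint convexity at the pair `(0,0), (2,2)`. -/
theorem dr_submodular_not_midpoint_convex :
    let f₁ : (Fin 2 → ℤ) → ℝ := fun v => -((v 0 : ℝ))^2 - 2 * (v 0 : ℝ) * (v 1 : ℝ)
    -- (i) DR-submodularity (diminishing returns)
    (∀ x y : Fin 2 → ℤ, (∀ j, 0 ≤ x j ∧ x j ≤ 2) → (∀ j, 0 ≤ y j ∧ y j ≤ 2) →
      (∀ j, x j ≤ y j) → ∀ i : Fin 2, y i + 1 ≤ 2 →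
        f₁ (fun j => y j + if j = i then 1 else 0) - f₁ y ≤
          f₁ (fun j => x j + if j = i then 1 else 0) - f₁ x) ∧
    -- (ii) violation of discrete midpoint convexity at (0,0) and (2,2)
    f₁ ![0, 0] + f₁ ![2, 2] < 2 * f₁ ![1, 1] := by
  intro f₁
  refine ⟨fun x y _ _ hxy i _ => ?_, by norm_num [f₁]⟩
  have h₀ : (x 0 : ℝ) ≤ y 0 := by exact_mod_cast hxy 0
  have h₁ : (x 1 : ℝ) ≤ y 1 := by exact_mod_cast hxy 1
  fin_cases i <;> simp [f₁] <;> linarith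
end
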